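/- Let V be a finite-dimensional vector space over a p-adic field Λ_0 of degree a over Λ_1 (with Λ_0/Λ_1 unramified, generated by Frobenius τ), and let β: V → V be a τ^{-1}-semilinear bijective map with α = β^a the Λ_0-linear a-th iterate. Then the ord_q-Newton polygon of det(I − tα | V) is obtained from the ord-Newton polygon of det(I − tβ | V), computed with respect to a Λ_1-basis of V viewed as Λ_1-vector space, by shrinking both ordinates and abscissas by the factor 1/a (where q = p^a, ord(p)=1, ord_q(q)=1). -/

import Mathlib

/-- The Newton polygon of a polynomial `f` with respect to a valuation `v`, as a
function of the abscissa `x`: the value at `x` of the lower convex hull of the points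
`(j, v(f_j))` for `f_j ≠ 0`, i.e. the supremum of `m·x + b` over all affine functions
lying on or below all those points. -/
noncomputable def newtonPolygonFn {K : Type} [Semiring K] (v : K → ℝ)
    (f : Polynomial K) (x : ℝ) : ℝ :=
  sSup {y : ℝ | ∃ m b : ℝ, y = m * x + b ∧
    ∀ j : ℕ, f.coeff j ≠ 0 → m * j + b ≤ v (f.coeff j)}

open Polynomial Matrix

open scoped Kronecker

/-- Expanding a polynomial by `a` stretches abscissas and ordinates of its Newton polygon by `a`,
once the valuation is normalised by `1 / a`. -/
theorem newtonPolygonFn_expand {K : Type} [CommSemiring K] (v : K → ℝ) {a : ℕ} (ha : 0 < a)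
    (f : K[X]) (x : ℝ) :
    newtonPolygonFn (fun z => v z / a) f x =
      (1 / (a : ℝ)) * newtonPolygonFn v (expand K a f) ((a : ℝ) * x) := by
  have ha' : (0 : ℝ) < a := Nat.cast_pos.2 ha
  unfold newtonPolygonFn
  rw [← smul_eq_mul, ← Real.sSup_smul_of_nonneg (by positivity)]
  congr 1
  ext y
  simp only [Set.mem_ofPred_eq, Set.mem_smul_set, smul_eq_mul]
  constructor
  · rintro ⟨m, b, rfl, h⟩
    refine ⟨m * (a * x) + a * b, ⟨m, a * b, rfl, fun j hj => ?_⟩, by field_simp⟩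
    rw [coeff_expand ha] at hj ⊢
    split_ifs at hj ⊢ with hd
    · obtain ⟨k, rfl⟩ := hd
      rw [Nat.mul_div_cancel_left k ha] at hj ⊢
      have := (le_div_iff₀ ha').1 (h k hj)
      push_cast
      linarith
    · exact absurd rfl hj
  · rintro ⟨_, ⟨m, b, rfl, h⟩, rfl⟩
    refine ⟨m, b / a, by field_simp, fun j hj => ?_⟩
    have := h (a * j) (by rwa [coeff_expand_mul' ha])
    rw [coeff_expand_mul' ha] at this
    rw [le_div_iff₀ ha']
    push_cast at this
    field_simp
    linarith

namespace Matrix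

section BlockCyclic

variable {R ι : Type*} [CommRing R] [Fintype ι]

/-- The strictly lower part of a block cyclic matrix: blocks `A 1, …, A m` on the block
subdiagonal. -/
def blockSubdiagonal (m : ℕ) (A : ℕ → Matrix ι ι R) :
    Matrix (Fin (m + 1) × ι) (Fin (m + 1) × ι) R :=
  of fun r c => if (r.1 : ℕ) = c.1 + 1 then A r.1 r.2 c.2 else 0

/-- The block cyclic matrix with blocks `A 1, …, A m` on the block subdiagonal and `A 0` in the
upper right corner. -/
def blockCyclic (m : ℕ) (A : ℕ → Matrix ι ι R) :
    Matrix (Fin (m + 1) × ι) (Fin (m + 1) × ι) R :=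
  blockSubdiagonal m A +
    of fun r c => if r.1 = 0 ∧ c.1 = Fin.last m then A 0 r.2 c.2 else 0

theorem blockCyclic_mulVec_zero (m : ℕ) (A : ℕ → Matrix ι ι R) (y : Fin (m + 1) × ι → R)
    (j : ι) : (blockCyclic m A *ᵥ y) (0, j) = ∑ k, A 0 j k * y (Fin.last m, k) := by
  simp only [blockCyclic, blockSubdiagonal, mulVec, dotProduct, Fintype.sum_prod_type,
    Matrix.add_apply, of_apply]
  rw [Finset.sum_eq_single (Fin.last m)]
  · simp
  · intro c _ hc
    simp [hc]
  · simp

theorem blockCyclic_mulVec_succ (m : ℕ) (A : ℕ → Matrix ι ι R) (y : Fin (m + 1) × ι → R)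
    (i : Fin m) (j : ι) :
    (blockCyclic m A *ᵥ y) (i.succ, j) = ∑ k, A (i + 1) j k * y (i.castSucc, k) := by
  simp only [blockCyclic, blockSubdiagonal, mulVec, dotProduct, Fintype.sum_prod_type,
    Matrix.add_apply, of_apply]
  rw [Finset.sum_eq_single i.castSucc]
  · simp
  · intro c _ hc
    have : (i.succ : ℕ) ≠ c + 1 := fun h => hc <| Fin.ext <| by simpa using h.symm
    simp only [if_neg this]
    simp
  · simp

variable [DecidableEq ι]

/-- The product `A i * ⋯ * A 1`. -/
def descProd (A : ℕ → Matrix ι ι R) : ℕ → Matrix ι ι R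
  | 0 => 1
  | i + 1 => A (i + 1) * descProd A i

theorem det_one_sub_X_smul_blockSubdiagonal (m : ℕ) (A : ℕ → Matrix ι ι R) :
    (1 - (X : R[X]) • (blockSubdiagonal m A).map C).det = 1 := by
  have htri : (1 - (X : R[X]) • (blockSubdiagonal m A).map C).BlockTriangular
      (fun r => OrderDual.toDual r.1) := by
    intro r c h
    have h' : r.1 < c.1 := h
    have h1 : r ≠ c := fun e => h'.ne (congrArg Prod.fst e)
    have h2 : (r.1 : ℕ) ≠ c.1 + 1 := by have := Fin.lt_def.1 h'; omega
    simp [blockSubdiagonal, h1, h2]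
  rw [htri.det_fintype]
  refine Finset.prod_eq_one fun k _ => ?_
  rw [show (1 - (X : R[X]) • (blockSubdiagonal m A).map C).toSquareBlock
    (fun r => OrderDual.toDual r.1) k = 1 from ?_, det_one]
  ext1 r c
  have h : (r.1.1 : ℕ) ≠ c.1.1 + 1 := by
    have : r.1.1 = c.1.1 := OrderDual.toDual.injective (r.2.trans c.2.symm)
    rw [this]; omega
  simp [toSquareBlock_def, blockSubdiagonal, h, one_apply, Subtype.ext_iff]

theorem charpolyRev_blockCyclic (m : ℕ) (A : ℕ → Matrix ι ι R) :
    (blockCyclic m A).charpolyRev = expand R (m + 1) (A 0 * descProd A m).charpolyRev := by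
  set K : Matrix (Fin (m + 1) × ι) (Fin (m + 1) × ι) R[X] :=
    1 - (X : R[X]) • (blockSubdiagonal m A).map C with hK
  let S : Matrix (Fin (m + 1) × ι) ι R[X] :=
    of fun r k => X ^ (r.1 : ℕ) * C (descProd A r.1 r.2 k)
  let P : Matrix (Fin (m + 1) × ι) ι R[X] := of fun r k => if r = (0, k) then 1 else 0
  let Q : Matrix ι (Fin (m + 1) × ι) R[X] := of fun k c => if (Fin.last m, k) = c then 1 else 0
  have hKS : K * S = P := by
    rw [hK, Matrix.sub_mul, Matrix.one_mul]
    ext1 ⟨i, j⟩ k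
    simp only [sub_apply, mul_apply, smul_apply, map_apply, blockSubdiagonal, of_apply, S, P,
      Fintype.sum_prod_type, smul_eq_mul]
    refine Fin.cases ?_ (fun i => ?_) i
    · simp [descProd, one_apply, Prod.ext_iff, apply_ite C]
    · rw [Finset.sum_eq_single i.castSucc]
      · simp [descProd, mul_apply, Finset.mul_sum, pow_succ, Prod.ext_iff]
        rw [sub_eq_zero]
        refine Finset.sum_congr rfl fun l _ => by ring
      · intro b _ hb
        have : (i.succ : ℕ) ≠ b + 1 := fun h => hb <| Fin.ext <| by
          simpa using h.symm
        simp only [if_neg this]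
        simp
      · simp
  have hQS : Q * S = (X : R[X]) ^ m • (descProd A m).map C := by
    ext1 j k
    simp [mul_apply, Q, S]
  have hcorner : 1 - (X : R[X]) • (blockCyclic m A).map C =
      K - P * (((X : R[X]) • (A 0).map C) * Q) := by
    have : P * (((X : R[X]) • (A 0).map C) * Q) = (X : R[X]) •
        (of fun r c => if r.1 = 0 ∧ c.1 = Fin.last m then A 0 r.2 c.2 else 0 :
          Matrix (Fin (m + 1) × ι) (Fin (m + 1) × ι) R).map C := by
      ext1 ⟨i, j⟩ ⟨i', k⟩
      by_cases h : i = 0 <;> by_cases h' : i' = Fin.last m <;>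
        simp [mul_apply, P, Q, h, h', Prod.ext_iff, eq_comm]
    rw [this, hK, blockCyclic, Matrix.map_add _ (map_add C), smul_add]
    abel
  calc (blockCyclic m A).charpolyRev
      = (K * (1 - S * (((X : R[X]) • (A 0).map C) * Q))).det := by
        rw [charpolyRev, hcorner, ← hKS, Matrix.mul_sub, Matrix.mul_one, Matrix.mul_assoc]
    _ = (1 - (X : R[X]) ^ (m + 1) • (A 0 * descProd A m).map C).det := by
        rw [det_mul, hK, det_one_sub_X_smul_blockSubdiagonal, one_mul, det_one_sub_mul_comm,
          Matrix.mul_assoc, hQS, Matrix.map_mul, smul_mul_smul_comm, pow_succ']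
    _ = expand R (m + 1) (A 0 * descProd A m).charpolyRev := by
        rw [charpolyRev, AlgHom.map_det]
        generalize A 0 * descProd A m = B
        congr 1
        ext1 i j
        simp [one_apply, apply_ite]

end BlockCyclic

end Matrix

section Semilinear

variable {F L V ι : Type*} [Field F] [Field L] [Algebra F L] [AddCommGroup V] [Module L V]
  [Fintype ι]

/-- The matrix of the images of the basis `e` under a map `g`, with respect to `e`. -/
noncomputable def imageMatrix (e : Module.Basis ι L V) (g : V → V) : Matrix ι ι L :=
  of fun j k => e.repr (g (e k)) j

theorem repr_semilinear (τ : L ≃ₐ[F] L) (β : V →+ V)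
    (hβ : ∀ (c : L) (x : V), β (c • x) = τ.symm c • β x) (e : Module.Basis ι L V) (x : V)
    (j : ι) :
    e.repr (β x) j = ∑ k, imageMatrix e β j k * τ.symm (e.repr x k) := by
  conv_lhs => rw [← e.sum_repr x, map_sum]
  simp [hβ, imageMatrix, mul_comm]

theorem imageMatrix_iterate_succ (τ : L ≃ₐ[F] L) (β : V →+ V)
    (hβ : ∀ (c : L) (x : V), β (c • x) = τ.symm c • β x) (e : Module.Basis ι L V) (i : ℕ) :
    imageMatrix e (β^[i + 1]) = imageMatrix e β * (imageMatrix e β^[i]).map τ.symm := by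
  ext j k
  rw [mul_apply, imageMatrix, of_apply, Function.iterate_succ_apply', repr_semilinear τ β hβ]
  rfl

theorem descProd_map_pow [DecidableEq ι] (τ : L ≃ₐ[F] L) (β : V →+ V)
    (hβ : ∀ (c : L) (x : V), β (c • x) = τ.symm c • β x) (e : Module.Basis ι L V) (i : ℕ) :
    descProd (fun i => (imageMatrix e β).map (τ ^ i : L ≃ₐ[F] L)) i =
      (imageMatrix e β^[i]).map (τ ^ i : L ≃ₐ[F] L) := by
  induction i with
  | zero =>
    ext j k
    simp [descProd, imageMatrix, Finsupp.single_apply, one_apply, eq_comm]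
  | succ i ih =>
    rw [descProd, ih, imageMatrix_iterate_succ τ β hβ, Matrix.map_mul, Matrix.map_map]
    congr 2
    ext x
    simp [pow_succ]

theorem isUnit_of_pow_apply {m : ℕ} (τ : L ≃ₐ[F] L) (hτ : orderOf τ = m + 1)
    (w : Module.Basis (Fin (m + 1)) F L) :
    IsUnit (of fun i l => (τ ^ (i : ℕ)) (w l) : Matrix (Fin (m + 1)) (Fin (m + 1)) L) := by
  rw [← linearIndependent_rows_iff_isUnit, Fintype.linearIndependent_iff]
  intro g hg
  have hinj : Function.Injective
      (fun i : Fin (m + 1) => ((τ ^ (i : ℕ) : L ≃ₐ[F] L) : L →* L)) := by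
    intro i j hij
    have : τ ^ (i : ℕ) = τ ^ (j : ℕ) := AlgEquiv.ext fun x => DFunLike.congr_fun hij x
    exact Fin.ext (pow_injOn_Iio_orderOf (by simpa [hτ] using i.2) (by simpa [hτ] using j.2) this)
  have hli := (linearIndependent_monoidHom L L).comp _ hinj
  rw [Fintype.linearIndependent_iff] at hli
  refine hli g ?_
  have hzero : ∑ i, g i • ((τ ^ (i : ℕ) : L ≃ₐ[F] L).toLinearMap) = 0 :=
    w.ext fun l => by simpa [Matrix.row] using congrFun hg l
  ext x
  simpa using LinearMap.congr_fun hzero x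

/-- For a `τ⁻¹`-semilinear map `β` whose `a`-th iterate is `α`, with `τ` generating the Galois group
of a cyclic extension of degree `a`, the reversed characteristic polynomials satisfy
`det (1 - t β) = det (1 - t ^ a α)`. -/
theorem reverse_charpoly_semilinear [Module F V] [IsScalarTower F L V]
    [FiniteDimensional L V] [FiniteDimensional F V]
    {a : ℕ} (ha : 0 < a) (hdeg : Module.finrank F L = a) (τ : L ≃ₐ[F] L) (hτ : orderOf τ = a)
    (β : V →+ V) (hβ : ∀ (c : L) (x : V), β (c • x) = τ.symm c • β x)
    (α : V →ₗ[L] V) (hα : ∀ x : V, α x = β^[a] x)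
    (βF : V →ₗ[F] V) (hβF : ∀ x : V, βF x = β x) :
    ((LinearMap.charpoly βF).map (algebraMap F L)).reverse =
      expand L a (LinearMap.charpoly α).reverse := by
  obtain ⟨m, rfl⟩ : ∃ m, a = m + 1 := ⟨a - 1, by omega⟩
  have : FiniteDimensional F L := Module.finite_of_finrank_pos (hdeg ▸ ha)
  let e := Module.finBasis L V
  let w : Module.Basis (Fin (m + 1)) F L := Module.finBasisOfFinrankEq F L hdeg
  let b := w.smulTower e
  let M := LinearMap.toMatrix b b βF
  let A : ℕ → Matrix _ _ L := fun i => (imageMatrix e β).map (τ ^ i : L ≃ₐ[F] L)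
  let y : V → Fin (m + 1) × Fin (Module.finrank L V) → L := fun x r =>
    (τ ^ (r.1 : ℕ)) (e.repr x r.2)
  let W : Matrix (Fin (m + 1) × Fin (Module.finrank L V))
    (Fin (m + 1) × Fin (Module.finrank L V)) L := of fun r c => y (b c) r
  have hW : IsUnit W := by
    have : W = (of fun i l => (τ ^ (i : ℕ)) (w l) :
        Matrix (Fin (m + 1)) (Fin (m + 1)) L) ⊗ₖ 1 := by
      ext ⟨i, j⟩ ⟨l, k⟩
      by_cases h : j = k <;>
        simp [-AlgEquiv.coe_pow, W, y, b, Module.Basis.smulTower_apply, Finsupp.single_apply,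
          one_apply, h, eq_comm]
    rw [this, isUnit_iff_isUnit_det, det_kronecker, det_one, one_pow, mul_one]
    exact ((isUnit_iff_isUnit_det _).1 (isUnit_of_pow_apply τ hτ w)).pow _
  have hτm : τ ^ m = τ.symm := by
    refine eq_inv_of_mul_eq_one_left ?_
    rw [← pow_succ, ← hτ, pow_orderOf_eq_one]
  have hy : ∀ x, y (β x) = blockCyclic m A *ᵥ y x := by
    intro x
    ext ⟨i, j⟩
    refine Fin.cases ?_ (fun i => ?_) i
    · simp [y, repr_semilinear τ β hβ e, blockCyclic_mulVec_zero, A, hτm,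
        -AlgEquiv.coe_pow]
    · simp [y, repr_semilinear τ β hβ e, blockCyclic_mulVec_succ, A, pow_succ,
        -AlgEquiv.coe_pow]
  have hconj : W * M.map (algebraMap F L) = blockCyclic m A * W := by
    ext r c
    have h1 : (blockCyclic m A * W) r c = y (βF (b c)) r := by
      rw [hβF, hy]
      rfl
    rw [h1, ← b.sum_repr (βF (b c))]
    simp only [y, mul_apply, W, of_apply, map_sum, Finsupp.finsetSum_apply, map_apply, M,
      LinearMap.toMatrix_apply]
    refine Finset.sum_congr rfl fun d _ => ?_
    rw [← algebraMap_smul L (b.repr (βF (b c)) d) (b d), map_smul, Finsupp.smul_apply,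
      smul_eq_mul, map_mul, AlgEquiv.commutes, mul_comm]
  have hchar : (M.map (algebraMap F L)).charpoly = (blockCyclic m A).charpoly := by
    obtain ⟨u, hu⟩ := hW
    rw [← charpoly_units_conj u, hu, hconj, ← hu, Matrix.mul_assoc, ← Matrix.coe_units_inv,
      Units.mul_inv, Matrix.mul_one]
  have hαmat : A 0 * descProd A m = LinearMap.toMatrix e e α := by
    rw [descProd_map_pow τ β hβ, hτm]
    have : A 0 = imageMatrix e β := by ext; simp [A]
    rw [this, ← imageMatrix_iterate_succ τ β hβ]
    ext j k
    rw [LinearMap.toMatrix_apply, hα]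
    rfl
  rw [← LinearMap.charpoly_toMatrix βF b, ← charpoly_map, hchar, reverse_charpoly,
    charpolyRev_blockCyclic, hαmat, ← reverse_charpoly, LinearMap.charpoly_toMatrix]

end Semilinear

/-- Dwork's lemma: let `Λ₀/Λ₁` be an unramified extension of `p`-adic fields of degree
`a`, with `Gal(Λ₀/Λ₁)` generated by (a lift of) Frobenius `τ`, `ord` a valuation on `Λ₀`
with `ord p = 1`, and `q = p^a` so that `ord_q = ord / a`.  Let `V` be a
finite-dimensional `Λ₀`-vector space and `β : V → V` a bijective `τ⁻¹`-semilinear map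
with `Λ₀`-linear `a`-th iterate `α = β^a`.  Then the `ord_q`-Newton polygon of
`det(I − tα | V)` is obtained from the `ord`-Newton polygon of `det(I − tβ)` (with `β`
viewed as a `Λ₁`-linear endomorphism of `V` as a `Λ₁`-vector space) by shrinking both
ordinates and abscissas by the factor `1/a`:
`NP_{ord_q}(det(I − tα))(x) = (1/a)·NP_{ord}(det(I − tβ))(a·x)` for `0 ≤ x ≤ dim_{Λ₀} V`.
Here `det(I − tα)` is realized as the reverse of the characteristic polynomial. -/
theorem stmt18 (p a : ℕ) (hp : p.Prime) (ha : 0 < a)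
    (Λ₁ Λ₀ : Type) [Field Λ₁] [Field Λ₀] [Algebra Λ₁ Λ₀]
    (hdeg : Module.finrank Λ₁ Λ₀ = a)
    (τ : Λ₀ ≃ₐ[Λ₁] Λ₀) (hτ : orderOf τ = a)
    (v : Λ₀ → ℝ)
    (hv_mul : ∀ x y : Λ₀, x ≠ 0 → y ≠ 0 → v (x * y) = v x + v y)
    (hv_add : ∀ x y : Λ₀, x ≠ 0 → y ≠ 0 → x + y ≠ 0 → min (v x) (v y) ≤ v (x + y))
    (hvp : v ((p : ℕ) : Λ₀) = 1)
    (V : Type) [AddCommGroup V] [Module Λ₀ V] [Module Λ₁ V] [IsScalarTower Λ₁ Λ₀ V]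
    [FiniteDimensional Λ₀ V] [FiniteDimensional Λ₁ V]
    (β : V →+ V) (hβbij : Function.Bijective β)
    (hβ : ∀ (c : Λ₀) (x : V), β (c • x) = τ.symm c • β x)
    (α : V →ₗ[Λ₀] V) (hα : ∀ x : V, α x = β^[a] x)
    (βL : V →ₗ[Λ₁] V) (hβL : ∀ x : V, βL x = β x) :
    ∀ x : ℝ, 0 ≤ x → x ≤ (Module.finrank Λ₀ V : ℝ) →
      newtonPolygonFn (fun z => v z / a) (LinearMap.charpoly α).reverse x =
        (1 / (a : ℝ)) *
          newtonPolygonFn v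
            (((LinearMap.charpoly βL).map (algebraMap Λ₁ Λ₀)).reverse) ((a : ℝ) * x) := by
  intro x _ _
  rw [reverse_charpoly_semilinear ha hdeg τ hτ β hβ α hα βL hβL]
  exact newtonPolygonFn_expand v ha _ x
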